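/- arXiv:2012.14925 — 6 statements merged into one kernel-verified Lean document; each statement's English description precedes it below -/
import Mathlib

section
/- Let A, M, and φ be n×n real matrices with M and φ symmetric positive definite. If A has a complex eigenvalue of modulus greater than or equal to 1, then the sequence t ↦ Tr((Aᵀ)^t M A^t φ) is not summable, i.e., the series ∑_{t=0}^∞ Tr((Aᵀ)^t M A^t φ) diverges. -/
open Matrix

open scoped MatrixOrder Matrix.Norms.L2Operator in
/-- A positive definite real matrix is `Bᵀ * B` for some invertible `B`. -/
theorem Matrix.PosDef.exists_isUnit_transpose_mul_self {n : Type*} [Fintype n] [DecidableEq n]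
    {M : Matrix n n ℝ} (hM : M.PosDef) : ∃ B : Matrix n n ℝ, IsUnit B ∧ M = Bᵀ * B := by
  obtain ⟨B, rfl⟩ := CStarAlgebra.nonneg_iff_eq_star_mul_self.mp hM.posSemidef.nonneg
  refine ⟨B, ?_, by rw [star_eq_conjTranspose, conjTranspose_eq_transpose_of_trivial]⟩
  have h := hM.isUnit
  rw [isUnit_iff_isUnit_det, det_mul] at h
  exact (isUnit_iff_isUnit_det B).mpr (isUnit_of_mul_isUnit_right h)

theorem Matrix.sq_apply_le_trace_transpose_mul_self {m n : Type*} [Fintype m] [Fintype n]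
    (X : Matrix m n ℝ) (i : m) (j : n) : X i j ^ 2 ≤ (Xᵀ * X).trace := by
  have h : (Xᵀ * X).trace = ∑ l, ∑ k, X k l ^ 2 := by
    simp [trace, mul_apply, sq]
  rw [h]
  calc X i j ^ 2 ≤ ∑ k, X k j ^ 2 :=
        Finset.single_le_sum (f := fun k => X k j ^ 2) (fun _ _ => sq_nonneg _) (Finset.mem_univ i)
    _ ≤ ∑ l, ∑ k, X k l ^ 2 :=
        Finset.single_le_sum (f := fun l => ∑ k, X k l ^ 2)
          (fun _ _ => Finset.sum_nonneg fun _ _ => sq_nonneg _) (Finset.mem_univ j)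

open Filter Topology in
/-- A sequence of real matrices tends to zero if its squared Frobenius norms do. -/
theorem Matrix.tendsto_zero_of_trace_transpose_mul_self {m n ι : Type*} [Fintype m] [Fintype n]
    {l : Filter ι} {X : ι → Matrix m n ℝ}
    (h : Tendsto (fun t => ((X t)ᵀ * X t).trace) l (𝓝 0)) : Tendsto X l (𝓝 0) := by
  refine tendsto_pi_nhds.mpr fun i => tendsto_pi_nhds.mpr fun j => ?_
  have hsq : Tendsto (fun t => X t i j ^ 2) l (𝓝 0) :=
    squeeze_zero (fun _ => sq_nonneg _)
      (fun t => sq_apply_le_trace_transpose_mul_self (X t) i j) h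
  have habs := hsq.sqrt
  simp only [Real.sqrt_sq_eq_abs, Real.sqrt_zero] at habs
  exact (tendsto_zero_iff_abs_tendsto_zero _).mpr habs

open Filter Topology in
/-- If the powers of a complex matrix tend to zero, its spectrum lies in the open unit disc. -/
theorem Matrix.norm_lt_one_of_mem_spectrum_of_tendsto_pow {n : Type*} [Fintype n] [DecidableEq n]
    {A : Matrix n n ℂ} (h : Tendsto (fun t : ℕ => A ^ t) atTop (𝓝 0))
    {μ : ℂ} (hμ : μ ∈ spectrum ℂ A) : ‖μ‖ < 1 := by
  rw [← spectrum_toLin', ← Module.End.hasEigenvalue_iff_mem_spectrum] at hμ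
  obtain ⟨v, hv⟩ := hμ.exists_hasEigenvector
  have hpow (t : ℕ) : A ^ t *ᵥ v = μ ^ t • v := by
    rw [← toLin'_apply, toLin'_pow]
    exact hv.pow_apply t
  have hlim : Tendsto (fun t : ℕ => A ^ t *ᵥ v) atTop (𝓝 (0 *ᵥ v)) :=
    ((continuous_id.matrix_mulVec continuous_const).tendsto 0).comp h
  simp only [hpow, zero_mulVec] at hlim
  obtain ⟨i, hi⟩ := Function.ne_iff.mp hv.2
  have hi_lim := (tendsto_pi_nhds.mp hlim i).mul_const (v i)⁻¹
  simp only [Pi.smul_apply, smul_eq_mul, Pi.zero_apply, zero_mul] at hi_lim hi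
  simp only [mul_inv_cancel_right₀ hi] at hi_lim
  exact tendsto_pow_atTop_nhds_zero_iff_norm_lt_one.mp hi_lim

/-- If the real matrix `A` has a complex eigenvalue of modulus at least `1`,
and `M`, `φ` are symmetric positive definite, then `t ↦ Tr((Aᵀ)^t M A^t φ)`
is not summable. -/
theorem stmt1 {n : ℕ} (A M φ : Matrix (Fin n) (Fin n) ℝ)
    (hM : M.PosDef) (hφ : φ.PosDef)
    (hA : ∃ μ : ℂ, μ ∈ spectrum ℂ (A.map Complex.ofReal) ∧ 1 ≤ ‖μ‖) :
    ¬ Summable (fun t : ℕ => ((Aᵀ) ^ t * M * A ^ t * φ).trace) := by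
  obtain ⟨μ, hμ, hμ_norm⟩ := hA
  obtain ⟨B, hB, rfl⟩ := hM.exists_isUnit_transpose_mul_self
  obtain ⟨C, hC, rfl⟩ := hφ.exists_isUnit_transpose_mul_self
  intro hsum
  have htrace (t : ℕ) : ((Aᵀ) ^ t * (Bᵀ * B) * A ^ t * (Cᵀ * C)).trace =
      ((B * A ^ t * Cᵀ)ᵀ * (B * A ^ t * Cᵀ)).trace := by
    rw [← Matrix.mul_assoc _ Cᵀ C, trace_mul_comm]
    simp only [transpose_mul, transpose_pow, transpose_transpose, Matrix.mul_assoc]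
  have hlim := hsum.tendsto_atTop_zero
  simp only [htrace] at hlim
  have hX := tendsto_zero_of_trace_transpose_mul_self hlim
  have hB_inv := nonsing_inv_mul B ((isUnit_iff_isUnit_det B).mp hB)
  have hC_inv := mul_nonsing_inv Cᵀ (by
    rw [det_transpose]
    exact (isUnit_iff_isUnit_det C).mp hC)
  have hA_pow := (hX.const_mul B⁻¹).mul_const (Cᵀ)⁻¹
  have hcancel (t : ℕ) : B⁻¹ * (B * A ^ t * Cᵀ) * (Cᵀ)⁻¹ = A ^ t := by
    calc B⁻¹ * (B * A ^ t * Cᵀ) * (Cᵀ)⁻¹ = (B⁻¹ * B) * A ^ t * (Cᵀ * (Cᵀ)⁻¹) := by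
          simp only [Matrix.mul_assoc]
      _ = A ^ t := by rw [hB_inv, hC_inv, Matrix.one_mul, Matrix.mul_one]
  simp only [hcancel, mul_zero, zero_mul] at hA_pow
  have hmap := ((continuous_id.matrix_map Complex.continuous_ofReal).tendsto
    (0 : Matrix (Fin n) (Fin n) ℝ)).comp hA_pow
  have hmap_pow (t : ℕ) : (A ^ t).map Complex.ofReal = A.map Complex.ofReal ^ t :=
    map_pow Complex.ofRealHom.mapMatrix A t
  simp only [Function.comp_def, id, hmap_pow, Matrix.map_zero _ Complex.ofReal_zero] at hmap
  exact (norm_lt_one_of_mem_spectrum_of_tendsto_pow hmap hμ).not_ge hμ_norm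
end

section
/- Let W be an n×n real symmetric positive definite matrix and let A be an n×n real matrix that has a complex eigenvalue λ with |λ| ≥ 1. Then there exists a constant c > 0 such that Tr((Aᵀ)^t W A^t) ≥ c for every t ∈ ℕ; in particular the terms of the series ∑_t Tr((Aᵀ)^t W A^t) do not tend to zero. -/
open Matrix

open scoped Matrix.Norms.Frobenius

/-- The squared Frobenius norm of a real matrix is the trace of its Gram matrix. -/
theorem frobenius_norm_sq_eq_trace {n : ℕ} (B : Matrix (Fin n) (Fin n) ℝ) :
    ‖B‖ ^ 2 = (Bᵀ * B).trace := by
  rw [Matrix.frobenius_norm_def, ← Real.sqrt_eq_rpow, Real.sq_sqrt (by positivity),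
    Finset.sum_comm]
  simp [Matrix.trace, Matrix.mul_apply, sq]

/-- Powers of a matrix with an eigenvalue of modulus at least one have Frobenius norm
bounded below. -/
theorem one_le_frobenius_norm_pow_mul {n : ℕ} (A : Matrix (Fin n) (Fin n) ℝ)
    (μ : ℂ) (hμ : μ ∈ spectrum ℂ (A.map Complex.ofReal)) (hμ1 : 1 ≤ ‖μ‖) (t : ℕ) :
    1 ≤ ‖A ^ t‖ * ‖(1 : Matrix (Fin n) (Fin n) ℂ)‖ := by
  have h := spectrum.norm_le_norm_mul_of_mem (spectrum.pow_mem_pow _ t hμ)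
  have hmap : (A.map Complex.ofReal) ^ t = (A ^ t).map Complex.ofReal :=
    (map_pow (Complex.ofRealHom.mapMatrix) A t).symm
  rw [hmap, Matrix.frobenius_norm_map_eq _ _ (fun a => Complex.norm_real a), norm_pow] at h
  exact (one_le_pow₀ hμ1).trans h

/-- If `W` is symmetric positive definite and the real matrix `A` has a complex
eigenvalue `μ` with `|μ| ≥ 1`, then the traces `Tr((Aᵀ)^t W A^t)` are uniformly
bounded below by some positive constant `c`. -/
theorem stmt2 {n : ℕ} (W A : Matrix (Fin n) (Fin n) ℝ) (hW : W.PosDef)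
    (μ : ℂ) (hμ : μ ∈ spectrum ℂ (A.map Complex.ofReal)) (hμ1 : 1 ≤ ‖μ‖) :
    ∃ c : ℝ, 0 < c ∧ ∀ t : ℕ, c ≤ ((Aᵀ) ^ t * W * A ^ t).trace := by
  obtain ⟨C, hC⟩ : ∃ C : Matrix (Fin n) (Fin n) ℝ, W = Cᵀ * C := by
    open scoped MatrixOrder in
    obtain ⟨C, hC⟩ := CStarAlgebra.nonneg_iff_eq_star_mul_self.mp hW.posSemidef.nonneg
    exact ⟨C, by simpa [Matrix.star_eq_conjTranspose] using hC⟩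
  have hCu : IsUnit C.det := by
    have h := (Matrix.isUnit_iff_isUnit_det _).1 hW.isUnit
    rw [hC, Matrix.det_mul] at h
    exact isUnit_of_mul_isUnit_right h
  have htrace (t : ℕ) : ((Aᵀ) ^ t * W * A ^ t).trace = ‖C * A ^ t‖ ^ 2 := by
    rw [frobenius_norm_sq_eq_trace, hC, Matrix.transpose_mul, Matrix.transpose_pow]
    simp only [Matrix.mul_assoc]
  set K : ℝ := ‖C⁻¹‖ * ‖(1 : Matrix (Fin n) (Fin n) ℂ)‖ with hK
  have hbound (t : ℕ) : 1 ≤ K * ‖C * A ^ t‖ := by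
    have hle : ‖A ^ t‖ ≤ ‖C⁻¹‖ * ‖C * A ^ t‖ := by
      simpa [Matrix.nonsing_inv_mul_cancel_left _ _ hCu] using norm_mul_le C⁻¹ (C * A ^ t)
    calc 1 ≤ ‖A ^ t‖ * ‖(1 : Matrix (Fin n) (Fin n) ℂ)‖ :=
          one_le_frobenius_norm_pow_mul A μ hμ hμ1 t
      _ ≤ ‖C⁻¹‖ * ‖C * A ^ t‖ * ‖(1 : Matrix (Fin n) (Fin n) ℂ)‖ := by gcongr
      _ = K * ‖C * A ^ t‖ := by rw [hK]; ring
  have hKpos : 0 < K := pos_of_mul_pos_left (one_pos.trans_le (hbound 0)) (norm_nonneg _)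
  refine ⟨K⁻¹ ^ 2, by positivity, fun t => ?_⟩
  rw [htrace]
  gcongr
  exact (inv_le_iff_one_le_mul₀' hKpos).2 (hbound t)
end

section
/- Let β > 0, let Q be a q×q real symmetric positive semidefinite matrix, R a p×p real symmetric positive definite matrix, L a q×q real symmetric positive semidefinite matrix, A a q×q real matrix, and B a q×p real matrix. Then R + βBᵀLB is positive definite (hence invertible), and for every x ∈ ℝ^q and every u ∈ ℝ^p, xᵀQx + uᵀRu + β(Ax+Bu)ᵀL(Ax+Bu) ≥ xᵀL⁺x, where L⁺ = Q + βAᵀLA − βAᵀLB(R+βBᵀLB)⁻¹βBᵀLA; moreover equality holds if and only if u = −(R+βBᵀLB)⁻¹βBᵀLA x. -/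
open Matrix

/-- Moving a matrix across the dot product, up to transposition. -/
theorem dotProduct_transpose_mulVec_comm {m n : Type*} [Fintype m] [Fintype n]
    (M : Matrix m n ℝ) (x : n → ℝ) (y : m → ℝ) : x ⬝ᵥ Mᵀ *ᵥ y = y ⬝ᵥ M *ᵥ x := by
  rw [mulVec_transpose, dotProduct_comm, ← dotProduct_mulVec]

/-- Completion of squares for a quadratic form with invertible symmetric matrix `S` and
cross term `G`. -/
theorem dotProduct_mulVec_add_inv_mul_mulVec {m n : Type*} [Fintype m] [Fintype n]
    [DecidableEq m] (S : Matrix m m ℝ) (hS : Sᵀ = S) (hU : IsUnit S) (G : Matrix m n ℝ)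
    (x : n → ℝ) (u : m → ℝ) :
    (u + (S⁻¹ * G) *ᵥ x) ⬝ᵥ S *ᵥ (u + (S⁻¹ * G) *ᵥ x) =
      u ⬝ᵥ S *ᵥ u + 2 * (u ⬝ᵥ G *ᵥ x) + x ⬝ᵥ (Gᵀ * S⁻¹ * G) *ᵥ x := by
  have hv : S *ᵥ ((S⁻¹ * G) *ᵥ x) = G *ᵥ x := by
    rw [mulVec_mulVec, ← Matrix.mul_assoc,
      mul_nonsing_inv S ((isUnit_iff_isUnit_det S).1 hU), Matrix.one_mul]
  have hc : ((S⁻¹ * G) *ᵥ x) ⬝ᵥ S *ᵥ u = u ⬝ᵥ G *ᵥ x := by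
    rw [← hv, ← dotProduct_transpose_mulVec_comm, hS]
  have hx : x ⬝ᵥ (Gᵀ * S⁻¹ * G) *ᵥ x = ((S⁻¹ * G) *ᵥ x) ⬝ᵥ G *ᵥ x := by
    rw [Matrix.mul_assoc, ← mulVec_mulVec, dotProduct_transpose_mulVec_comm]
  rw [mulVec_add, hv, dotProduct_add, add_dotProduct, add_dotProduct, hc, hx]
  ring

/-- One-step completion-of-squares for the Riccati update: `R + βBᵀLB` is positive
definite (hence invertible), the quadratic stage-plus-lookahead cost is bounded
below by `xᵀL⁺x` with `L⁺ = Q + βAᵀLA − βAᵀLB(R+βBᵀLB)⁻¹βBᵀLA`, and equality holds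
iff `u = −(R+βBᵀLB)⁻¹βBᵀLA x`. -/
theorem stmt7 {q p : ℕ} (β : ℝ) (hβ : 0 < β)
    (Q L A : Matrix (Fin q) (Fin q) ℝ) (R : Matrix (Fin p) (Fin p) ℝ)
    (B : Matrix (Fin q) (Fin p) ℝ)
    (hQ : Q.PosSemidef) (hR : R.PosDef) (hL : L.PosSemidef) :
    (R + β • (Bᵀ * L * B)).PosDef ∧ IsUnit (R + β • (Bᵀ * L * B)) ∧
    ∀ (x : Fin q → ℝ) (u : Fin p → ℝ),
      (x ⬝ᵥ Q *ᵥ x + u ⬝ᵥ R *ᵥ u +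
          β * ((A *ᵥ x + B *ᵥ u) ⬝ᵥ L *ᵥ (A *ᵥ x + B *ᵥ u)) ≥
        x ⬝ᵥ (Q + β • (Aᵀ * L * A) -
          (β • (Aᵀ * L * B)) * (R + β • (Bᵀ * L * B))⁻¹ * (β • (Bᵀ * L * A))) *ᵥ x) ∧
      (x ⬝ᵥ Q *ᵥ x + u ⬝ᵥ R *ᵥ u +
          β * ((A *ᵥ x + B *ᵥ u) ⬝ᵥ L *ᵥ (A *ᵥ x + B *ᵥ u)) =
        x ⬝ᵥ (Q + β • (Aᵀ * L * A) -
          (β • (Aᵀ * L * B)) * (R + β • (Bᵀ * L * B))⁻¹ * (β • (Bᵀ * L * A))) *ᵥ x ↔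
        u = -(((R + β • (Bᵀ * L * B))⁻¹ * (β • (Bᵀ * L * A))) *ᵥ x)) := by
  have hLt : Lᵀ = L := by simpa using hL.isHermitian.eq
  have hS : (R + β • (Bᵀ * L * B)).PosDef := by
    have h := (hL.conjTranspose_mul_mul_same B).smul hβ.le
    rw [conjTranspose_eq_transpose_of_trivial] at h
    exact hR.add_posSemidef h
  refine ⟨hS, hS.isUnit, fun x u => ?_⟩
  have hSt : (R + β • (Bᵀ * L * B))ᵀ = R + β • (Bᵀ * L * B) := by
    simpa using hS.isHermitian.eq
  have hG : (β • (Bᵀ * L * A))ᵀ = β • (Aᵀ * L * B) := by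
    simp [transpose_mul, hLt, Matrix.mul_assoc]
  have key : x ⬝ᵥ Q *ᵥ x + u ⬝ᵥ R *ᵥ u +
        β * ((A *ᵥ x + B *ᵥ u) ⬝ᵥ L *ᵥ (A *ᵥ x + B *ᵥ u)) =
      x ⬝ᵥ (Q + β • (Aᵀ * L * A) -
        (β • (Aᵀ * L * B)) * (R + β • (Bᵀ * L * B))⁻¹ * (β • (Bᵀ * L * A))) *ᵥ x +
      (u + ((R + β • (Bᵀ * L * B))⁻¹ * (β • (Bᵀ * L * A))) *ᵥ x) ⬝ᵥ
        (R + β • (Bᵀ * L * B)) *ᵥ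
          (u + ((R + β • (Bᵀ * L * B))⁻¹ * (β • (Bᵀ * L * A))) *ᵥ x) := by
    have hpull : ∀ {k l : ℕ} (M : Matrix (Fin q) (Fin k) ℝ) (N : Matrix (Fin q) (Fin l) ℝ)
        (y : Fin k → ℝ) (z : Fin l → ℝ),
        y ⬝ᵥ (Mᵀ * L * N) *ᵥ z = (M *ᵥ y) ⬝ᵥ L *ᵥ (N *ᵥ z) := by
      intro k l M N y z
      rw [Matrix.mul_assoc, ← mulVec_mulVec, dotProduct_transpose_mulVec_comm,
        ← mulVec_mulVec, dotProduct_comm]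
    have hcross : (A *ᵥ x) ⬝ᵥ L *ᵥ (B *ᵥ u) = (B *ᵥ u) ⬝ᵥ L *ᵥ (A *ᵥ x) := by
      rw [← dotProduct_transpose_mulVec_comm, hLt]
    rw [dotProduct_mulVec_add_inv_mul_mulVec _ hSt hS.isUnit, hG, sub_mulVec, dotProduct_sub]
    simp only [add_mulVec, mulVec_add, smul_mulVec, dotProduct_add, add_dotProduct,
      dotProduct_smul, smul_eq_mul, hpull, hcross]
    ring
  rw [key]
  refine ⟨le_add_of_nonneg_right (hS.posSemidef.dotProduct_mulVec_nonneg _), ?_⟩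
  rw [add_eq_left, eq_neg_iff_add_eq_zero]
  refine ⟨fun h => ?_, fun h => by rw [h, zero_dotProduct]⟩
  by_contra hne
  have hpos := hS.dotProduct_mulVec_pos hne
  rw [star_trivial, h] at hpos
  exact lt_irrefl _ hpos
end

section
/- Let β > 0, let Q be a q×q real symmetric positive semidefinite matrix, R a p×p real symmetric positive definite matrix, A a q×q real matrix, and B a q×p real matrix. If L is a q×q real symmetric positive semidefinite matrix, then the Riccati update L⁺ = Q + βAᵀLA − βAᵀLB(R+βBᵀLB)⁻¹βBᵀLA is also symmetric positive semidefinite. -/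
open Matrix

/-- If the gain `K` satisfies `(R + βBᵀLB) K = βBᵀLA`, the Riccati update equals its Joseph
form `Q + KᵀRK + β(A − BK)ᵀL(A − BK)`. -/
theorem riccati_eq_joseph_form {m n S : Type*} [Fintype m] [Fintype n] [CommRing S] (β : S)
    (Q L A : Matrix m m S) (R : Matrix n n S) (B : Matrix m n S) (K : Matrix n m S)
    (hK : (R + β • (Bᵀ * L * B)) * K = β • (Bᵀ * L * A)) :
    Q + β • (Aᵀ * L * A) - β • (Aᵀ * L * B) * K =
      Q + Kᵀ * R * K + β • ((A - B * K)ᵀ * L * (A - B * K)) := by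
  have h := congrArg (Kᵀ * ·) hK
  simp only [Matrix.add_mul, Matrix.mul_add, Matrix.smul_mul, Matrix.mul_smul,
    Matrix.mul_assoc] at h
  simp only [transpose_sub, transpose_mul, Matrix.sub_mul, Matrix.mul_sub, Matrix.smul_mul,
    smul_sub, Matrix.mul_assoc]
  rw [← h]
  abel

/-- The Riccati update `L⁺ = Q + βAᵀLA − βAᵀLB(R+βBᵀLB)⁻¹βBᵀLA` maps symmetric
positive semidefinite matrices to symmetric positive semidefinite matrices. -/
theorem stmt8 {q p : ℕ} (β : ℝ) (hβ : 0 < β)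
    (Q L A : Matrix (Fin q) (Fin q) ℝ) (R : Matrix (Fin p) (Fin p) ℝ)
    (B : Matrix (Fin q) (Fin p) ℝ)
    (hQ : Q.PosSemidef) (hR : R.PosDef) (hL : L.PosSemidef) :
    (Q + β • (Aᵀ * L * A) -
      (β • (Aᵀ * L * B)) * (R + β • (Bᵀ * L * B))⁻¹ * (β • (Bᵀ * L * A))).PosSemidef := by
  have psd_conj {m n : ℕ} {M : Matrix (Fin m) (Fin m) ℝ} (hM : M.PosSemidef)
      (C : Matrix (Fin m) (Fin n) ℝ) : (Cᵀ * M * C).PosSemidef := by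
    simpa only [conjTranspose_eq_transpose_of_trivial] using hM.conjTranspose_mul_mul_same C
  have hD : IsUnit (R + β • (Bᵀ * L * B)).det :=
    (isUnit_iff_isUnit_det _).mp (hR.add_posSemidef ((psd_conj hL B).smul hβ.le)).isUnit
  rw [Matrix.mul_assoc (β • (Aᵀ * L * B)),
    riccati_eq_joseph_form β Q L A R B _ (mul_nonsing_inv_cancel_left _ _ hD)]
  exact (hQ.add (psd_conj hR.posSemidef _)).add ((psd_conj hL _).smul hβ.le)
end

section
/- Let β ∈ (0,1), O ≥ 0, and let g : ℕ → ℝ satisfy g(T) ≥ 0 for all T. Define Φ : ℝ → ℝ by Φ(r) = inf_{T ≥ 1} ( g(T) + β^T (r + O) ). Then Φ is well defined (the infimum is finite for every r), Φ is a contraction with constant β, i.e., |Φ(r₁) − Φ(r₂)| ≤ β|r₁ − r₂| for all r₁, r₂ ∈ ℝ, and consequently Φ has a unique fixed point r ∈ ℝ with r = Φ(r). -/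
theorem abs_pow_mul_le_abs_mul {β : ℝ} (hβ0 : 0 ≤ β) (hβ1 : β ≤ 1) {T : ℕ} (hT : 1 ≤ T)
    (x : ℝ) : |β ^ T * x| ≤ β * |x| := by
  rw [abs_mul, abs_of_nonneg (pow_nonneg hβ0 T)]
  exact mul_le_mul_of_nonneg_right (pow_le_of_le_one hβ0 hβ1 (by lia)) (abs_nonneg x)

/-- For `β ∈ (0,1)`, `O ≥ 0` and `g ≥ 0`, the map
`Φ(r) = inf_{T ≥ 1} (g T + β^T (r + O))` is well defined (the infimum is over a
nonempty set that is bounded below), it is a `β`-contraction, and it has a unique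
fixed point. -/
theorem stmt10 (β O : ℝ) (hβ0 : 0 < β) (hβ1 : β < 1) (hO : 0 ≤ O)
    (g : ℕ → ℝ) (hg : ∀ T : ℕ, 0 ≤ g T) :
    (∀ r : ℝ, {y : ℝ | ∃ T : ℕ, 1 ≤ T ∧ y = g T + β ^ T * (r + O)}.Nonempty ∧
      BddBelow {y : ℝ | ∃ T : ℕ, 1 ≤ T ∧ y = g T + β ^ T * (r + O)}) ∧
    (∀ r₁ r₂ : ℝ,
      |sInf {y : ℝ | ∃ T : ℕ, 1 ≤ T ∧ y = g T + β ^ T * (r₁ + O)} -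
        sInf {y : ℝ | ∃ T : ℕ, 1 ≤ T ∧ y = g T + β ^ T * (r₂ + O)}| ≤
        β * |r₁ - r₂|) ∧
    (∃! r : ℝ, r = sInf {y : ℝ | ∃ T : ℕ, 1 ≤ T ∧ y = g T + β ^ T * (r + O)}) := by
  have hne : ∀ r : ℝ, {y : ℝ | ∃ T : ℕ, 1 ≤ T ∧ y = g T + β ^ T * (r + O)}.Nonempty :=
    fun r => ⟨_, 1, le_rfl, rfl⟩
  have hbdd : ∀ r : ℝ, BddBelow {y : ℝ | ∃ T : ℕ, 1 ≤ T ∧ y = g T + β ^ T * (r + O)} := by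
    rintro r
    refine ⟨-(β * |r + O|), ?_⟩
    rintro y ⟨T, hT, rfl⟩
    linarith [hg T, (abs_le.mp (abs_pow_mul_le_abs_mul hβ0.le hβ1.le hT (r + O))).1]
  have hle : ∀ r₁ r₂ : ℝ,
      sInf {y : ℝ | ∃ T : ℕ, 1 ≤ T ∧ y = g T + β ^ T * (r₁ + O)} - β * |r₁ - r₂| ≤
        sInf {y : ℝ | ∃ T : ℕ, 1 ≤ T ∧ y = g T + β ^ T * (r₂ + O)} := by
    intro r₁ r₂
    refine le_csInf (hne r₂) ?_
    rintro y ⟨T, hT, rfl⟩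
    have h := csInf_le (hbdd r₁) ⟨T, hT, rfl⟩
    linarith [(abs_le.mp (abs_pow_mul_le_abs_mul hβ0.le hβ1.le hT (r₁ - r₂))).2]
  have hcontr : ∀ r₁ r₂ : ℝ,
      |sInf {y : ℝ | ∃ T : ℕ, 1 ≤ T ∧ y = g T + β ^ T * (r₁ + O)} -
        sInf {y : ℝ | ∃ T : ℕ, 1 ≤ T ∧ y = g T + β ^ T * (r₂ + O)}| ≤
        β * |r₁ - r₂| := by
    intro r₁ r₂
    have h := hle r₂ r₁
    rw [abs_sub_comm r₂ r₁] at h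
    exact abs_le.mpr ⟨by linarith, by linarith [hle r₁ r₂]⟩
  have hΦ : ContractingWith ⟨β, hβ0.le⟩
      (fun r : ℝ => sInf {y : ℝ | ∃ T : ℕ, 1 ≤ T ∧ y = g T + β ^ T * (r + O)}) :=
    ⟨hβ1, LipschitzWith.of_dist_le_mul hcontr⟩
  exact ⟨fun r => ⟨hne r, hbdd r⟩, hcontr, _, hΦ.fixedPoint_isFixedPt.symm,
    fun r hr => hΦ.fixedPoint_unique hr.symm⟩
end

section
/- Let β ∈ (0,1), let c : ℕ → ℝ be a sequence with c(t) ≥ 0 for all t, let a, O be real numbers, and let T* ≥ 1 be an integer. Define the partial sums p_t = ∑_{τ=0}^{t−1} c(τ), set r = ( ∑_{t=0}^{T*−1} β^t p_t + β^{T*} O )/(1 − β^{T*}) + βa/(1 − β), and define h(T) = p_T + βa − (1−β)(r+O). Then h(T*) > 0 if and only if O < ∑_{t=0}^{T*−1} ((1 − β^{t+1})/(1 − β)) c(t); and, when T* ≥ 2, h(T*−1) ≤ 0 if and only if O ≥ ∑_{t=0}^{T*−2} ((1 − β^{t+1})/(1 − β)) c(t). -/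
/-- Summation by parts for the geometrically discounted partial sums of `c`. -/
theorem discounted_partial_sums_identity {R : Type*} [CommRing R] (β : R) (c : ℕ → R) (n : ℕ) :
    (1 - β) * ∑ t ∈ Finset.range n, β ^ t * ∑ τ ∈ Finset.range t, c τ +
      ∑ t ∈ Finset.range n, (1 - β ^ (t + 1)) * c t =
    (1 - β ^ n) * ∑ τ ∈ Finset.range n, c τ := by
  induction n with
  | zero => simp
  | succ n ih =>
    simp only [Finset.sum_range_succ]
    linear_combination ih

/-- With nonnegative `c`, partial sums `p t = ∑_{τ<t} c τ`,
`r = (∑_{t<T*} β^t p t + β^{T*} O)/(1 − β^{T*}) + βa/(1 − β)` and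
`h T = p T + βa − (1−β)(r+O)`, one has `h T* > 0` iff
`O < ∑_{t<T*} ((1 − β^{t+1})/(1 − β)) c t`, and (for `T* ≥ 2`)
`h (T*−1) ≤ 0` iff `O ≥ ∑_{t<T*−1} ((1 − β^{t+1})/(1 − β)) c t`. -/
theorem stmt14 (β O a : ℝ) (hβ0 : 0 < β) (hβ1 : β < 1)
    (c : ℕ → ℝ) (hc : ∀ t : ℕ, 0 ≤ c t)
    (Tstar : ℕ) (hTstar : 1 ≤ Tstar)
    (p : ℕ → ℝ) (hp : ∀ t : ℕ, p t = ∑ τ ∈ Finset.range t, c τ)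
    (r : ℝ)
    (hr : r = (∑ t ∈ Finset.range Tstar, β ^ t * p t + β ^ Tstar * O) / (1 - β ^ Tstar) +
      β * a / (1 - β))
    (h : ℕ → ℝ) (hh : ∀ T : ℕ, h T = p T + β * a - (1 - β) * (r + O)) :
    (0 < h Tstar ↔
      O < ∑ t ∈ Finset.range Tstar, ((1 - β ^ (t + 1)) / (1 - β)) * c t) ∧
    (2 ≤ Tstar → (h (Tstar - 1) ≤ 0 ↔
      O ≥ ∑ t ∈ Finset.range (Tstar - 1), ((1 - β ^ (t + 1)) / (1 - β)) * c t)) := by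
  have hN : 0 < 1 - β ^ Tstar := sub_pos.2 (pow_lt_one₀ hβ0.le hβ1 (by omega))
  have hb : 0 < 1 - β := sub_pos.2 hβ1
  have key : ∀ n, (1 - β) * ∑ t ∈ Finset.range n, β ^ t * p t +
      (1 - β) * ∑ t ∈ Finset.range n, ((1 - β ^ (t + 1)) / (1 - β)) * c t =
      (1 - β ^ n) * p n := by
    intro n
    have := discounted_partial_sums_identity β c n
    simp only [← hp] at this
    rw [← this, Finset.mul_sum (Finset.range n) (fun t => (1 - β ^ (t + 1)) / (1 - β) * c t)]
    congr 1
    refine Finset.sum_congr rfl fun t _ => ?_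
    field_simp
  have hval : ∀ T, (1 - β ^ Tstar) * h T =
      (1 - β ^ Tstar) * p T - (1 - β) * (∑ t ∈ Finset.range Tstar, β ^ t * p t + O) := by
    intro T
    rw [hh, hr]
    field_simp
    ring
  constructor
  · have e : (1 - β ^ Tstar) * h Tstar = (1 - β) *
        (∑ t ∈ Finset.range Tstar, ((1 - β ^ (t + 1)) / (1 - β)) * c t - O) := by
      linear_combination hval Tstar - key Tstar
    rw [← mul_pos_iff_of_pos_left hN, e, mul_pos_iff_of_pos_left hb, sub_pos]
  · intro _
    obtain ⟨n, rfl⟩ : ∃ n, Tstar = n + 1 := ⟨Tstar - 1, by omega⟩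
    rw [Nat.add_sub_cancel]
    have e : (1 - β ^ (n + 1)) * h n = (1 - β) *
        (∑ t ∈ Finset.range n, ((1 - β ^ (t + 1)) / (1 - β)) * c t - O) := by
      have hv := hval n
      rw [Finset.sum_range_succ] at hv
      linear_combination hv - key n
    rw [← not_lt, ← mul_pos_iff_of_pos_left hN, e, mul_pos_iff_of_pos_left hb, sub_pos, not_lt]
end
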